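/- Let p and q be positive integers and let Y be the collection of all subsets of Fin p × Fin q that contain no horizontal path (the graph of no nondecreasing function β : Fin q → Fin p is contained in them). Then the maximal elements of Y under inclusion are exactly the complements of graphs of vertical paths, i.e., a set F is a maximal element of Y if and only if F = (Fin p × Fin q) \ graph(α) for some nondecreasing function α : Fin p → Fin q. -/

import Mathlib

/-- The graph of a vertical path `α : Fin p → Fin q`, as a subset of the grid. -/
def verticalGraph {p q : ℕ} (α : Fin p → Fin q) : Set (Fin p × Fin q) :=
  {x : Fin p × Fin q | x.2 = α x.1}

/-- The graph of a horizontal path `β : Fin q → Fin p`, as a subset of the grid. -/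
def horizontalGraph {p q : ℕ} (β : Fin q → Fin p) : Set (Fin p × Fin q) :=
  {x : Fin p × Fin q | x.1 = β x.2}

/-- The simplicial complex `Y` of subsets of the grid containing no horizontal path. -/
def containsNoHorizontalPath {p q : ℕ} (F : Set (Fin p × Fin q)) : Prop :=
  ∀ β : Fin q → Fin p, Monotone β → ¬ horizontalGraph β ⊆ F

/-- The greedy lower envelope of a relation on `ℕ × ℕ`, capped at height `p`: from each column to the
next it climbs to the first row related to the column, or to `p` if there is none below `p`. -/
theorem exists_greedy_envelope (p : ℕ) (P : ℕ → ℕ → Prop) :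
    ∃ g : ℕ → ℕ, g 0 = 0 ∧ Monotone g ∧
      (∀ j, g (j + 1) < p → P (g (j + 1)) j) ∧
      ∀ i j, g j ≤ i → i < g (j + 1) → ¬ P i j := by
  classical
  have step : ∀ j a, ∃ b, a ≤ p → a ≤ b ∧ b ≤ p ∧ (b < p → P b j) ∧
      ∀ i, a ≤ i → i < b → ¬ P i j := by
    intro j a
    by_cases ha : a ≤ p
    · have hex : ∃ b, a ≤ b ∧ (b < p → P b j) := ⟨p, ha, fun h => absurd h (lt_irrefl p)⟩
      have hle : Nat.find hex ≤ p := Nat.find_min' hex ⟨ha, fun h => absurd h (lt_irrefl p)⟩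
      exact ⟨Nat.find hex, fun _ => ⟨(Nat.find_spec hex).1, hle, (Nat.find_spec hex).2,
        fun i hi hlt hP => Nat.find_min hex hlt ⟨hi, fun _ => hP⟩⟩⟩
    · exact ⟨0, fun h => absurd h ha⟩
  choose f hf using step
  let g : ℕ → ℕ := fun n => Nat.rec 0 f n
  have hg : ∀ j, g j ≤ p := by
    intro j
    induction j with
    | zero => exact Nat.zero_le p
    | succ j ih => exact (hf j (g j) ih).2.1
  exact ⟨g, rfl, monotone_nat_of_le_succ fun j => (hf j (g j) (hg j)).1,
    fun j => (hf j (g j) (hg j)).2.2.1, fun i j => (hf j (g j) (hg j)).2.2.2 i⟩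

/-- A set without horizontal path avoids some vertical path. -/
theorem exists_verticalGraph_avoiding {p q : ℕ} {F : Set (Fin p × Fin q)}
    (hF : containsNoHorizontalPath F) :
    ∃ α : Fin p → Fin q, Monotone α ∧ F ⊆ Set.univ \ verticalGraph α := by
  classical
  obtain ⟨g, hg0, hmono, hmem, hnot⟩ := exists_greedy_envelope p
    fun i j => ∃ (hi : i < p) (hj : j < q), ((⟨i, hi⟩, ⟨j, hj⟩) : Fin p × Fin q) ∈ F
  have hgq : p ≤ g q := by
    by_contra! hlt
    have hb : ∀ j : Fin q, g (j + 1) < p := fun j => (hmono j.isLt).trans_lt hlt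
    refine hF (fun j => ⟨g (j + 1), hb j⟩) (fun a b hab => hmono (Nat.succ_le_succ hab)) ?_
    rintro ⟨i, j⟩ hij
    obtain rfl : i = ⟨g (j + 1), hb j⟩ := hij
    exact (hmem j (hb j)).2.2
  have hex : ∀ i : Fin p, ∃ n, (i : ℕ) < g n := fun i => ⟨q, i.isLt.trans_le hgq⟩
  have hpos : ∀ i : Fin p, 0 < Nat.find (hex i) := fun i =>
    Nat.pos_of_ne_zero fun h => by
      have := Nat.find_spec (hex i)
      rw [h, hg0] at this
      exact Nat.not_lt_zero _ this
  have hfind : ∀ i : Fin p, Nat.find (hex i) ≤ q := fun i =>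
    Nat.find_min' (hex i) (i.isLt.trans_le hgq)
  refine ⟨fun i => ⟨Nat.find (hex i) - 1, by have := hpos i; have := hfind i; omega⟩, ?_, ?_⟩
  · intro a b hab
    exact Nat.sub_le_sub_right
      (Nat.find_min' (hex a) (lt_of_le_of_lt hab (Nat.find_spec (hex b)))) 1
  · rintro ⟨i, j⟩ hij
    refine ⟨trivial, fun hα => ?_⟩
    have hj : (j : ℕ) = Nat.find (hex i) - 1 := congrArg Fin.val hα
    refine hnot i j ?_ ?_ ⟨i.isLt, j.isLt, hij⟩
    · rw [hj]
      exact not_lt.mp (Nat.find_min (hex i) (Nat.sub_lt (hpos i) Nat.one_pos))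
    · rw [hj, Nat.sub_add_cancel (hpos i)]
      exact Nat.find_spec (hex i)

/-- A monotone self-map of a nonempty `Fin p` has a fixed point. -/
theorem Fin.exists_fixedPoint_of_monotone {p : ℕ} (hp : 0 < p) {f : Fin p → Fin p}
    (hf : Monotone f) : ∃ i, f i = i := by
  obtain ⟨i, hi, hmin⟩ := (Set.toFinite {i : Fin p | f i ≤ i}).exists_minimal
    ⟨⟨p - 1, by omega⟩, Fin.le_def.mpr (Nat.le_sub_one_of_lt (f _).isLt)⟩
  exact ⟨i, le_antisymm hi (hmin (hf hi) hi)⟩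

/-- Every horizontal path meets every vertical path. -/
theorem containsNoHorizontalPath_compl_verticalGraph {p q : ℕ} (hp : 0 < p)
    {α : Fin p → Fin q} (hα : Monotone α) :
    containsNoHorizontalPath (Set.univ \ verticalGraph α) := by
  intro β hβ hsub
  obtain ⟨i, hi⟩ := Fin.exists_fixedPoint_of_monotone hp (hβ.comp hα)
  have hmem : (i, α i) ∈ horizontalGraph β := hi.symm
  exact (hsub hmem).2 rfl

/-- Two vertical paths with comparable complements coincide. -/
theorem eq_of_compl_verticalGraph_subset {p q : ℕ} {α γ : Fin p → Fin q}
    (h : Set.univ \ verticalGraph α ⊆ Set.univ \ verticalGraph γ) : γ = α := by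
  funext i
  by_contra hne
  have hmem : (i, γ i) ∈ Set.univ \ verticalGraph α := ⟨trivial, hne⟩
  exact (h hmem).2 rfl

/-- The facets of the complex `Y` of subsets of `Fin p × Fin q` containing no horizontal
path are exactly the complements of graphs of vertical paths. -/
theorem facets_of_no_horizontal_path_complex (p q : ℕ) (hp : 0 < p) (hq : 0 < q)
    (F : Set (Fin p × Fin q)) :
    (containsNoHorizontalPath F ∧
      ∀ G : Set (Fin p × Fin q), containsNoHorizontalPath G → F ⊆ G → G = F) ↔
    (∃ α : Fin p → Fin q, Monotone α ∧ F = Set.univ \ verticalGraph α) := by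
  constructor
  · rintro ⟨hF, hmax⟩
    obtain ⟨α, hα, hsub⟩ := exists_verticalGraph_avoiding hF
    exact ⟨α, hα, (hmax _ (containsNoHorizontalPath_compl_verticalGraph hp hα) hsub).symm⟩
  · rintro ⟨α, hα, rfl⟩
    refine ⟨containsNoHorizontalPath_compl_verticalGraph hp hα, fun G hG hsub => ?_⟩
    obtain ⟨γ, -, hγ⟩ := exists_verticalGraph_avoiding hG
    obtain rfl := eq_of_compl_verticalGraph_subset (hsub.trans hγ)
    exact hγ.antisymm hsub
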